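/- arXiv:1706.09385 — 2 statements merged into one kernel-verified Lean document; each statement's English description precedes it below -/
import Mathlib

section
/- Let T: 𝕋^i → 𝕋^i, Tx = xA + b, with A upper-triangular unipotent integer matrix with a_{i−1,i} ≠ 0. Let ω be an orbit of the action of Aᵀ on ℤ^i, fix l⁽⁰⁾ ∈ ω with last coordinate l_i ≠ 0, and write l⁽ᵏ⁾ = l⁽⁰⁾(Aᵀ)ᵏ. A trigonometric polynomial Ψ(x) = ∑_{l ∈ ω, |l|≤m, l_i ≠ 0} c_l e(l·x) is a smooth coboundary for T (Ψ = u∘T − u with u smooth) if and only if ∑_{k=1}^{N} c_{l⁽ᵏ⁾} e(−∑_{j=0}^{k−1} l⁽ʲ⁾·b) + c_{l⁽⁰⁾} + ∑_{k=1}^{N−1} c_{l⁽⁻ᵏ⁾} e(∑_{j=1}^{k} l⁽⁻ʲ⁾·b) = 0, where N is such that c_{l⁽ⁿ⁾} = 0 for all n ≥ N. -/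
open Real Matrix

section Aux16
open MeasureTheory Filter Topology

noncomputable local instance instMSUnit16 : MeasureSpace UnitAddCircle := ⟨AddCircle.haarAddCircle⟩

local instance instHaarUnit16 : Measure.IsAddHaarMeasure (volume : Measure UnitAddCircle) :=
  inferInstanceAs (Measure.IsAddHaarMeasure AddCircle.haarAddCircle)

local instance instProbUnit16 : IsProbabilityMeasure (volume : Measure UnitAddCircle) :=
  inferInstanceAs (IsProbabilityMeasure AddCircle.haarAddCircle)

noncomputable def e16 (x : ℝ) : ℂ := Complex.exp (2 * (π : ℂ) * Complex.I * (x : ℂ))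

lemma e16_add (x y : ℝ) : e16 (x + y) = e16 x * e16 y := by
  simp only [e16, ← Complex.exp_add]; congr 1; push_cast; ring

lemma e16_ne (x : ℝ) : e16 x ≠ 0 := Complex.exp_ne_zero _

lemma e16_zero : e16 0 = 1 := by simp [e16]

lemma e16_norm (x : ℝ) : ‖e16 x‖ = 1 := by
  have : (2 * (π : ℂ) * Complex.I * (x : ℂ)) = ((2 * π * x : ℝ) : ℂ) * Complex.I := by
    push_cast; ring
  rw [e16, this, Complex.norm_exp_ofReal_mul_I]

lemma e16_int (m : ℤ) : e16 m = 1 := by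
  rw [e16, Complex.exp_eq_one_iff]
  exact ⟨m, by push_cast; ring⟩

def pr16 {n : ℕ} (x : Fin n → ℝ) : UnitAddTorus (Fin n) := fun i => (x i : UnitAddCircle)

lemma pr16_quot {n : ℕ} : IsOpenQuotientMap (pr16 (n := n)) := by
  have h : IsOpenQuotientMap (fun x : ℝ => (x : UnitAddCircle)) :=
    ⟨QuotientAddGroup.mk_surjective, continuous_quot_mk, QuotientAddGroup.isOpenMap_coe⟩
  exact IsOpenQuotientMap.piMap (fun _ : Fin n => h)

lemma mF16 {n : ℕ} (m : Fin n → ℤ) (x : Fin n → ℝ) :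
    UnitAddTorus.mFourier m (pr16 x) = e16 (∑ j, (m j : ℝ) * x j) := by
  simp only [UnitAddTorus.mFourier, ContinuousMap.coe_mk, pr16, fourier_coe_apply, e16,
    ← Complex.exp_sum]
  congr 1
  push_cast
  rw [Finset.mul_sum]
  refine Finset.sum_congr rfl fun i _ => ?_
  simp; ring

lemma desc16 {n : ℕ} (u : (Fin n → ℝ) → ℂ) (hu : Continuous u)
    (hp : ∀ x (p : Fin n → ℤ), u (x + fun j => (p j : ℝ)) = u x) :
    ∃ U : C(UnitAddTorus (Fin n), ℂ), ∀ x, U (pr16 x) = u x := by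
  have hs := (pr16_quot (n := n)).surjective
  have key : ∀ x, (u ∘ Function.surjInv hs) (pr16 x) = u x := by
    intro x
    have h1 : pr16 (Function.surjInv hs (pr16 x)) = pr16 x := Function.surjInv_eq hs _
    set y := Function.surjInv hs (pr16 x) with hy
    have h2 : ∀ i, ∃ p : ℤ, y i = x i + p := by
      intro i
      have h3 : ((y i : ℝ) : UnitAddCircle) = (x i : UnitAddCircle) := congrFun h1 i
      rw [← sub_eq_zero, ← AddCircle.coe_sub, AddCircle.coe_eq_zero_iff] at h3
      obtain ⟨p, hp⟩ := h3
      refine ⟨p, ?_⟩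
      simp only [zsmul_eq_mul, mul_one] at hp
      linarith
    choose p hp' using h2
    have : y = x + fun j => (p j : ℝ) := funext hp'
    simp only [Function.comp]
    rw [← hy, this, hp]
  refine ⟨⟨u ∘ Function.surjInv hs, ?_⟩, key⟩
  rw [pr16_quot.isQuotientMap.continuous_iff]
  convert hu using 1
  exact funext key

lemma RL16 {n : ℕ} (U : C(UnitAddTorus (Fin n), ℂ)) :
    Tendsto (UnitAddTorus.mFourierCoeff U) cofinite (𝓝 0) := by
  have h := (UnitAddTorus.hasSum_sq_mFourierCoeff (ContinuousMap.toLp (E := ℂ) 2 volume ℂ U)).summable.tendsto_cofinite_zero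
  simp only [UnitAddTorus.mFourierCoeff_toLp] at h
  rw [tendsto_zero_iff_norm_tendsto_zero]
  have := h.sqrt
  simpa using this

lemma orth16 {n : ℕ} (k m : Fin n → ℤ) :
    ∫ t : UnitAddTorus (Fin n), UnitAddTorus.mFourier (-k) t * UnitAddTorus.mFourier m t
      = if k = m then 1 else 0 := by
  have := (orthonormal_iff_ite.mp (UnitAddTorus.orthonormal_mFourier (d := Fin n))) k m
  rw [← this, ContinuousMap.inner_toLp]
  refine integral_congr_ae (ae_of_all _ fun t => ?_)
  simp [UnitAddTorus.mFourier_neg, mul_comm]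

noncomputable def phi16 {n : ℕ} (A : Matrix (Fin n) (Fin n) ℤ) :
    UnitAddTorus (Fin n) →+ UnitAddTorus (Fin n) where
  toFun t := fun j => ∑ i, A i j • t i
  map_zero' := by ext j; simp
  map_add' s t := by ext j; simp [smul_add, Finset.sum_add_distrib]

lemma phi16_mp {n : ℕ} (A C : Matrix (Fin n) (Fin n) ℤ) (hC : C * A = 1) :
    MeasurePreserving (phi16 A) volume volume := by
  refine AddMonoidHom.measurePreserving ?_ ?_ rfl
  · refine continuous_pi fun j => ?_
    change Continuous fun t : UnitAddTorus (Fin n) => ∑ i, A i j • t i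
    exact continuous_finsetSum _ fun i _ => Continuous.zsmul (by fun_prop) (A i j)
  · intro y
    refine ⟨phi16 C y, ?_⟩
    funext j
    simp only [phi16, AddMonoidHom.coe_mk, ZeroHom.coe_mk, Finset.smul_sum, smul_smul]
    rw [Finset.sum_comm]
    have : ∀ k, ∑ i, (A i j * C k i) • y k = (if k = j then (1:ℤ) else 0) • y k := by
      intro k
      rw [← Finset.sum_smul]
      congr 1
      have := congrFun (congrFun hC k) j
      rw [Matrix.mul_apply, Matrix.one_apply] at this
      rw [← this]
      exact Finset.sum_congr rfl fun i _ => mul_comm _ _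
    simp [this, ite_smul]

lemma tele0 (W : ℤ → ℂ) (N : ℕ) :
    ∑ k ∈ Finset.Icc (-(N:ℤ)) N, (W (k - 1) - W k) = W (-N - 1) - W N := by
  have h3 : ∀ j : ℕ, ∑ k ∈ Finset.Icc (-(N:ℤ)) (-N + j), (W (k - 1) - W k) = W (-N - 1) - W (-N + j) := by
    intro j
    induction j with
    | zero => simp
    | succ j ih =>
      have : Finset.Icc (-(N:ℤ)) (-N + (j+1:ℕ)) = insert (-(N:ℤ) + (j+1:ℕ)) (Finset.Icc (-(N:ℤ)) (-N + j)) := by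
        ext a; simp only [Finset.mem_Icc, Finset.mem_insert]; omega
      rw [this, Finset.sum_insert (by simp), ih,
        show -(N:ℤ) + (j+1:ℕ) - 1 = -N + j by push_cast; ring]
      ring
  have := h3 (2 * N)
  rwa [show -(N:ℤ) + (2 * N : ℕ) = N by push_cast; ring] at this

lemma tele16 (W d : ℤ → ℂ) (N : ℕ) (hd : ∀ k : ℤ, ((N : ℤ) ≤ k ∨ k ≤ -(N : ℤ)) → d k = 0)
    (hr : ∀ k, d k = W (k - 1) - W k) (hW : Tendsto W cofinite (𝓝 0)) :
    ∑ k ∈ Finset.Icc (-(N:ℤ)) N, d k = 0 := by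
  have h1 : ∀ j : ℕ, W (N + j) = W N := by
    intro j
    induction j with
    | zero => simp
    | succ j ih =>
      have := hr (N + (j + 1 : ℕ))
      rw [hd _ (Or.inl (by omega)), show (N:ℤ) + (j+1:ℕ) - 1 = N + j by push_cast; ring, ih] at this
      exact (sub_eq_zero.mp this.symm).symm
  have h2 : ∀ j : ℕ, W (-N - 1 - j) = W (-N - 1) := by
    intro j
    induction j with
    | zero => simp
    | succ j ih =>
      have := hr (-N - 1 - j)
      rw [hd _ (Or.inr (by omega)), ih] at this
      rw [show -(N:ℤ) - 1 - (j+1:ℕ) = -N - 1 - j - 1 by push_cast; ring]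
      exact (sub_eq_zero.mp this.symm)
  have z1 : W N = 0 := by
    have hi : Function.Injective (fun j : ℕ => (N:ℤ) + j) := fun a b h => by simpa using h
    have := hW.comp hi.tendsto_cofinite
    simp only [Function.comp_def, h1] at this
    exact tendsto_nhds_unique tendsto_const_nhds this
  have z2 : W (-N - 1) = 0 := by
    have hi : Function.Injective (fun j : ℕ => -(N:ℤ) - 1 - j) := fun a b h => by simpa using h
    have := hW.comp hi.tendsto_cofinite
    simp only [Function.comp_def, h2] at this
    exact tendsto_nhds_unique tendsto_const_nhds this
  have := tele0 W N
  rw [z1, z2, sub_zero] at this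
  rw [← this]
  exact Finset.sum_congr rfl fun k _ => hr k

lemma split16 (g : ℤ → ℂ) (N : ℕ) : ∑ k ∈ Finset.Icc (-(N:ℤ)) N, g k =
    ∑ k ∈ Finset.Icc 1 N, g (k:ℤ) + g 0 + ∑ k ∈ Finset.Icc 1 N, g (-(k:ℤ)) := by
  induction N with
  | zero => simp
  | succ N ih =>
    have : Finset.Icc (-((N+1:ℕ):ℤ)) (N+1:ℕ) =
        insert ((N+1:ℕ):ℤ) (insert (-((N+1:ℕ):ℤ)) (Finset.Icc (-(N:ℤ)) N)) := by
      ext a; simp only [Finset.mem_Icc, Finset.mem_insert]; omega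
    rw [this, Finset.sum_insert, Finset.sum_insert, ih, Finset.sum_Icc_succ_top (by omega),
      Finset.sum_Icc_succ_top (by omega)]
    · ring
    · simp
    · simp only [Finset.mem_Icc, Finset.mem_insert]; omega

noncomputable def Th16 (β : ℤ → ℝ) (k : ℤ) : ℝ :=
  ∑ j ∈ Finset.range k.toNat, β j - ∑ j ∈ Finset.Icc 1 (-k).toNat, β (-(j:ℤ))

lemma Th16_succ (β : ℤ → ℝ) (k : ℤ) : Th16 β (k + 1) = Th16 β k + β k := by
  unfold Th16
  obtain ⟨m, rfl | rfl⟩ := k.eq_nat_or_neg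
  · have h1 : ((m:ℤ) + 1).toNat = m + 1 := by omega
    have h2 : (-((m:ℤ) + 1)).toNat = 0 := by omega
    have h3 : (-((m:ℤ))).toNat = 0 := by omega
    rw [h1, h2, h3, Finset.sum_range_succ]; simp
  · cases m with
    | zero => simp
    | succ m =>
      have h1 : (-((m+1:ℕ):ℤ) + 1).toNat = 0 := by omega
      have h2 : (-(-((m+1:ℕ):ℤ) + 1)).toNat = m := by omega
      have h3 : (-(-((m+1:ℕ):ℤ))).toNat = m + 1 := by omega
      have h4 : (-((m+1:ℕ):ℤ)).toNat = 0 := by omega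
      rw [h1, h2, h3, h4, Finset.sum_Icc_succ_top (by omega)]
      ring

lemma orbit16 (n : ℕ) (A : Matrix (Fin n) (Fin n) ℤ)
    (M : (Matrix (Fin n) (Fin n) ℤ)ˣ) (hM : (M : Matrix (Fin n) (Fin n) ℤ) = Aᵀ)
    (l0 : Fin n → ℤ) (l : ℤ → Fin n → ℤ)
    (hl : ∀ k : ℤ, l k = Matrix.vecMul l0
      ((M ^ k : (Matrix (Fin n) (Fin n) ℤ)ˣ) : Matrix (Fin n) (Fin n) ℤ)) (k : ℤ) (i : Fin n) :
    l (k + 1) i = ∑ j, A i j * l k j := by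
  rw [hl (k + 1), _root_.zpow_add_one, Units.val_mul, ← Matrix.vecMul_vecMul, ← hl k, hM,
    Matrix.vecMul_transpose]
  rfl

lemma inj16 (n : ℕ) (hn : 2 ≤ n) (A : Matrix (Fin n) (Fin n) ℤ)
    (hUT : A.BlockTriangular id) (hdiag : ∀ i, A i i = 1)
    (p q : Fin n) (hp : (p : ℕ) = n - 2) (hq : (q : ℕ) = n - 1) (hsup : A p q ≠ 0)
    (l : ℤ → Fin n → ℤ) (hl0 : l 0 q ≠ 0)
    (hs : ∀ k i, l (k + 1) i = ∑ j, A i j * l k j) : Function.Injective l := by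
  have hpq : p ≠ q := fun h => by
    have := congrArg Fin.val h
    omega
  have h1 : ∀ k, l (k + 1) q = l k q := by
    intro k
    rw [hs, Finset.sum_eq_single q, hdiag, one_mul]
    · intro j _ hj
      rw [hUT, zero_mul]
      simp only [id, Fin.lt_def, hq]
      have : (j : ℕ) ≠ n - 1 := fun h => hj (Fin.ext (h.trans hq.symm))
      have := j.2
      omega
    · simp
  have h2 : ∀ k, l (k + 1) p = l k p + A p q * l k q := by
    intro k
    have hz : ∀ j, j ∉ ({p, q} : Finset (Fin n)) → A p j * l k j = 0 := by
      intro j hj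
      simp only [Finset.mem_insert, Finset.mem_singleton, not_or] at hj
      rw [hUT, zero_mul]
      simp only [id, Fin.lt_def, hp]
      have h3 : (j : ℕ) ≠ n - 1 := fun h => hj.2 (Fin.ext (h.trans (by omega)))
      have h4 : (j : ℕ) ≠ n - 2 := fun h => hj.1 (Fin.ext (h.trans (by omega)))
      have := j.2
      omega
    rw [hs, ← Finset.sum_subset (Finset.subset_univ {p, q}) (fun j _ hj => hz j hj),
      Finset.sum_pair hpq, hdiag, one_mul]
  have h3 : ∀ k, l k q = l 0 q := by
    intro k
    induction k using Int.induction_on with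
    | zero => rfl
    | succ k ih => rw [h1, ih]
    | pred k ih => rw [← ih, ← h1]; congr 2; ring
  have h4 : ∀ k, l k p = l 0 p + k * (A p q * l 0 q) := by
    intro k
    induction k using Int.induction_on with
    | zero => simp
    | succ k ih => rw [h2, ih, h3 k]; ring
    | pred k ih =>
      have := h2 (-(k:ℤ) - 1)
      rw [h3, sub_add_cancel, ih] at this
      linarith
  intro k m hkm
  have h5 := congrFun hkm p
  rw [h4 k, h4 m, add_right_inj] at h5
  exact mul_right_cancel₀ (mul_ne_zero hsup hl0) h5

lemma dual16 {n : ℕ} (A : Matrix (Fin n) (Fin n) ℤ) (b : Fin n → ℝ)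
    (T : (Fin n → ℝ) → Fin n → ℝ)
    (hT : ∀ x j, T x j = (∑ i, (A i j : ℝ) * x i) + b j) (l : ℤ → Fin n → ℤ)
    (hs : ∀ k i, l (k + 1) i = ∑ j, A i j * l k j) (k : ℤ) (x : Fin n → ℝ) :
    ∑ j, (l k j : ℝ) * T x j = ∑ j, (l (k + 1) j : ℝ) * x j + ∑ j, (l k j : ℝ) * b j := by
  simp only [hT, hs, mul_add, Finset.sum_add_distrib]
  congr 1
  push_cast
  simp only [Finset.mul_sum, Finset.sum_mul]
  rw [Finset.sum_comm]
  refine Finset.sum_congr rfl fun i _ => Finset.sum_congr rfl fun j _ => by ring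

lemma fwd16 {n : ℕ} (A C : Matrix (Fin n) (Fin n) ℤ) (hC : C * A = 1) (b : Fin n → ℝ)
    (T : (Fin n → ℝ) → Fin n → ℝ)
    (hT : ∀ x j, T x j = (∑ i, (A i j : ℝ) * x i) + b j) (l : ℤ → Fin n → ℤ)
    (hs : ∀ k i, l (k + 1) i = ∑ j, A i j * l k j) (hinj : Function.Injective l)
    (N : ℕ) (c : ℤ → ℂ) (hsupp : ∀ k : ℤ, ((N : ℤ) ≤ k ∨ k ≤ -(N : ℤ)) → c k = 0)
    (u : (Fin n → ℝ) → ℂ) (hu : Continuous u)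
    (hp : ∀ x (p : Fin n → ℤ), u (x + fun j => (p j : ℝ)) = u x)
    (he : ∀ x, ∑ k ∈ Finset.Icc (-(N : ℤ)) (N : ℤ), c k * e16 (∑ j, (l k j : ℝ) * x j)
      = u (T x) - u x) :
    ∃ w : ℤ → ℂ, Tendsto w cofinite (𝓝 0) ∧
      ∀ k, c k = e16 (∑ j, (l (k - 1) j : ℝ) * b j) * w (k - 1) - w k := by
  obtain ⟨U, hU⟩ := desc16 u hu hp
  refine ⟨fun k => UnitAddTorus.mFourierCoeff U (l k), (RL16 U).comp hinj.tendsto_cofinite, ?_⟩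
  intro m
  let S : UnitAddTorus (Fin n) → UnitAddTorus (Fin n) := fun t => phi16 A t + pr16 b
  have hS : MeasurePreserving S volume volume :=
    (measurePreserving_add_right volume (pr16 b)).comp (phi16_mp A C hC)
  have hScont : Continuous S := by
    refine Continuous.add ?_ continuous_const
    refine continuous_pi fun j => ?_
    change Continuous fun t : UnitAddTorus (Fin n) => ∑ i, A i j • t i
    exact continuous_finsetSum _ fun i _ => Continuous.zsmul (by fun_prop) (A i j)
  have hSpr : ∀ x, S (pr16 x) = pr16 (T x) := by
    intro x
    funext j
    simp only [S, phi16, pr16, AddMonoidHom.coe_mk, ZeroHom.coe_mk, Pi.add_apply, hT]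
    rw [AddCircle.coe_add]
    congr 1
    have h := map_sum (QuotientAddGroup.mk' (AddSubgroup.zmultiples (1 : ℝ)))
      (fun i => (A i j : ℝ) * x i) Finset.univ
    refine Eq.trans ?_ h.symm
    refine Finset.sum_congr rfl fun i _ => ?_
    rw [← zsmul_eq_mul, map_zsmul]
    rfl
  have hE : ∀ t, U (S t) = U t + ∑ k ∈ Finset.Icc (-(N : ℤ)) (N : ℤ),
      c k * UnitAddTorus.mFourier (l k) t := by
    intro t
    obtain ⟨x, rfl⟩ := pr16_quot.surjective t
    simp only [hSpr, hU, mF16, he]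
    ring
  have hF : ∀ t, UnitAddTorus.mFourier (-l m) t * U (S t) =
      e16 (∑ j, (l (m - 1) j : ℝ) * b j) *
        (UnitAddTorus.mFourier (-l (m - 1)) (S t) * U (S t)) := by
    intro t
    obtain ⟨x, rfl⟩ := pr16_quot.surjective t
    rw [hSpr, mF16, mF16, ← mul_assoc, ← e16_add]
    congr 2
    have := dual16 A b T hT l hs (m - 1) x
    rw [sub_add_cancel] at this
    simp only [Pi.neg_apply, Int.cast_neg, neg_mul, Finset.sum_neg_distrib]
    linarith
  have hint : ∀ f : UnitAddTorus (Fin n) → ℂ, Continuous f → Integrable f volume := by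
    intro f hf
    exact hf.integrable_of_hasCompactSupport (HasCompactSupport.of_compactSpace f)
  have I1 : ∫ t, UnitAddTorus.mFourier (-l m) t * U (S t) =
      e16 (∑ j, (l (m - 1) j : ℝ) * b j) * UnitAddTorus.mFourierCoeff U (l (m - 1)) := by
    simp only [hF]
    rw [integral_const_mul, UnitAddTorus.mFourierCoeff]
    congr 1
    have hm : AEStronglyMeasurable (fun t => UnitAddTorus.mFourier (-l (m - 1)) t * U t)
        (Measure.map S volume) := by
      rw [hS.map_eq]
      exact (hint _ (by fun_prop)).aestronglyMeasurable
    have := integral_map (μ := volume) hS.measurable.aemeasurable hm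
    rw [hS.map_eq] at this
    exact this.symm
  have I2 : ∫ t, UnitAddTorus.mFourier (-l m) t * U (S t) =
      UnitAddTorus.mFourierCoeff U (l m) + c m := by
    simp only [hE, mul_add, Finset.mul_sum]
    rw [integral_add (hint _ (by fun_prop)) (hint _ (by fun_prop)),
      integral_finsetSum _ (fun k _ => hint _ (by fun_prop))]
    congr 1
    have : ∀ k, ∫ t, UnitAddTorus.mFourier (-l m) t * (c k * UnitAddTorus.mFourier (l k) t)
        = if m = k then c k else 0 := by
      intro k
      simp only [mul_left_comm _ (c k)]
      rw [integral_const_mul, orth16]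
      simp [hinj.eq_iff]
    simp only [this, Finset.sum_ite_eq]
    split_ifs with h
    · rfl
    · rw [hsupp]
      simp only [Finset.mem_Icc] at h
      omega
  rw [I1] at I2
  rw [I2]; ring

lemma bwd16 {n : ℕ} (A : Matrix (Fin n) (Fin n) ℤ) (b : Fin n → ℝ)
    (T : (Fin n → ℝ) → Fin n → ℝ)
    (hT : ∀ x j, T x j = (∑ i, (A i j : ℝ) * x i) + b j) (l : ℤ → Fin n → ℤ)
    (hs : ∀ k i, l (k + 1) i = ∑ j, A i j * l k j) (N : ℕ) (c : ℤ → ℂ) (Θ : ℤ → ℝ)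
    (hΘ : ∀ k, Θ (k + 1) = Θ k + ∑ j, (l k j : ℝ) * b j)
    (h0 : ∑ k ∈ Finset.Icc (-(N : ℤ)) N, c k * e16 (-Θ k) = 0) :
    ∃ u : (Fin n → ℝ) → ℂ, ContDiff ℝ (⊤ : ℕ∞) u ∧
        (∀ x (p : Fin n → ℤ), u (x + fun j => (p j : ℝ)) = u x) ∧
        ∀ x, ∑ k ∈ Finset.Icc (-(N : ℤ)) (N : ℤ), c k * e16 (∑ j, (l k j : ℝ) * x j)
          = u (T x) - u x := by
  let V : ℤ → ℂ := fun k => -∑ j ∈ Finset.Icc (-(N:ℤ)) k, c j * e16 (-Θ j)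
  have hV : ∀ k ∈ Finset.Icc (-(N:ℤ)) N, V (k - 1) - V k = c k * e16 (-Θ k) := by
    intro k hk
    rw [Finset.mem_Icc] at hk
    have : Finset.Icc (-(N:ℤ)) k = insert k (Finset.Icc (-(N:ℤ)) (k - 1)) := by
      ext a; simp only [Finset.mem_Icc, Finset.mem_insert]; omega
    simp only [V]
    rw [this, Finset.sum_insert (by simp)]
    ring
  have hV1 : V (-N - 1) = 0 := by simp [V]
  have hV2 : V N = 0 := by simp only [V, h0, neg_zero]
  refine ⟨fun x => ∑ k ∈ Finset.Icc (-(N:ℤ)) N, V k * (e16 (Θ k) * e16 (∑ j, (l k j : ℝ) * x j)),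
    ?_, ?_, ?_⟩
  · unfold e16
    refine ContDiff.sum fun k _ => contDiff_const.mul (contDiff_const.mul ?_)
    refine ContDiff.cexp (contDiff_const.mul ?_)
    refine Complex.ofRealCLM.contDiff.comp ?_
    refine ContDiff.sum (s := Finset.univ) (f := fun (j : Fin n) (x : Fin n → ℝ) => (l k j : ℝ) * x j) fun j _ => ?_
    exact contDiff_const.mul (contDiff_apply ℝ ℝ j)
  · intro x p
    refine Finset.sum_congr rfl fun k _ => ?_
    congr 2
    have : ∑ j, (l k j : ℝ) * (x + fun j => (p j : ℝ)) j =
        ∑ j, (l k j : ℝ) * x j + ((∑ j, l k j * p j : ℤ) : ℝ) := by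
      simp [mul_add, Finset.sum_add_distrib]
    rw [this, e16_add, e16_int, mul_one]
  · intro x
    have hF : ∀ k, e16 (Θ k) * e16 (∑ j, (l k j : ℝ) * T x j) =
        e16 (Θ (k + 1)) * e16 (∑ j, (l (k + 1) j : ℝ) * x j) := by
      intro k
      rw [dual16 A b T hT l hs, hΘ, ← e16_add, ← e16_add]
      congr 1; ring
    have ht := tele0 (fun k => V k * (e16 (Θ (k + 1)) * e16 (∑ j, (l (k + 1) j : ℝ) * x j))) N
    simp only [hV1, hV2, zero_mul, sub_zero, sub_add_cancel, Finset.sum_sub_distrib] at ht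
    simp only [hF]
    rw [← sub_eq_zero.mp ht, ← Finset.sum_sub_distrib]
    refine Finset.sum_congr rfl fun k hk => ?_
    rw [← sub_mul, hV k hk, mul_assoc, ← mul_assoc (e16 (-Θ k)), ← e16_add]
    simp [e16_zero]

end Aux16

/-- Characterization of smooth coboundaries for a skew-translation `T x = xA + b` on
`𝕋^n` (periodic model, `a_{n−1,n} ≠ 0`): the trigonometric polynomial
`Ψ = ∑_k c_k e(l⁽ᵏ⁾·x)` supported on the `Aᵀ`-orbit of `l⁽⁰⁾` (last coordinate
nonzero) is a smooth coboundary `Ψ = u∘T − u` if and only if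
`∑_{k=1}^{N} c_k e(−∑_{j=0}^{k−1} l⁽ʲ⁾·b) + c_0 + ∑_{k=1}^{N−1} c_{−k} e(∑_{j=1}^{k} l⁽⁻ʲ⁾·b) = 0`. -/
theorem stmt_16 (n : ℕ) (hn : 2 ≤ n) (A : Matrix (Fin n) (Fin n) ℤ)
    (hUT : A.BlockTriangular id) (hdiag : ∀ i, A i i = 1)
    (hsup : A ⟨n - 2, by omega⟩ ⟨n - 1, by omega⟩ ≠ 0)
    (b : Fin n → ℝ) (T : (Fin n → ℝ) → Fin n → ℝ)
    (hT : ∀ x j, T x j = (∑ i, (A i j : ℝ) * x i) + b j)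
    (M : (Matrix (Fin n) (Fin n) ℤ)ˣ) (hM : (M : Matrix (Fin n) (Fin n) ℤ) = Aᵀ)
    (l0 : Fin n → ℤ) (hl0 : l0 ⟨n - 1, by omega⟩ ≠ 0)
    (l : ℤ → Fin n → ℤ)
    (hl : ∀ k : ℤ, l k = Matrix.vecMul l0
      ((M ^ k : (Matrix (Fin n) (Fin n) ℤ)ˣ) : Matrix (Fin n) (Fin n) ℤ))
    (N : ℕ) (hN : 1 ≤ N)
    (c : ℤ → ℂ) (hsupp : ∀ k : ℤ, ((N : ℤ) ≤ k ∨ k ≤ -(N : ℤ)) → c k = 0)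
    (Ψ : (Fin n → ℝ) → ℂ)
    (hΨ : ∀ x, Ψ x = ∑ k ∈ Finset.Icc (-(N : ℤ)) (N : ℤ),
      c k * Complex.exp (2 * (π : ℂ) * Complex.I * ((∑ j, (l k j : ℝ) * x j : ℝ) : ℂ))) :
    (∃ u : (Fin n → ℝ) → ℂ, ContDiff ℝ (⊤ : ℕ∞) u ∧
        (∀ x (p : Fin n → ℤ), u (x + fun j => (p j : ℝ)) = u x) ∧
        ∀ x, Ψ x = u (T x) - u x)
    ↔ ((∑ k ∈ Finset.Icc 1 N, c (k : ℤ) *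
          Complex.exp (2 * (π : ℂ) * Complex.I *
            ((-(∑ j ∈ Finset.range k, ∑ i, (l (j : ℤ) i : ℝ) * b i) : ℝ) : ℂ)))
        + c 0
        + (∑ k ∈ Finset.Icc 1 (N - 1), c (-(k : ℤ)) *
          Complex.exp (2 * (π : ℂ) * Complex.I *
            (((∑ j ∈ Finset.Icc 1 k, ∑ i, (l (-(j : ℤ)) i : ℝ) * b i : ℝ)) : ℂ)))
        = 0) := by
  have hs := orbit16 n A M hM l0 l hl
  have hl00 : l 0 = l0 := by rw [hl]; simp
  have hinj := inj16 n hn A hUT hdiag _ _ rfl rfl hsup l (by rw [hl00]; exact hl0) hs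
  let Θ := Th16 (fun k => ∑ i, (l k i : ℝ) * b i)
  have hΘ : ∀ k, Θ (k + 1) = Θ k + ∑ j, (l k j : ℝ) * b j := Th16_succ _
  have hC : ((M⁻¹ : (Matrix (Fin n) (Fin n) ℤ)ˣ) : Matrix (Fin n) (Fin n) ℤ)ᵀ * A = 1 := by
    have h1 : (M : Matrix (Fin n) (Fin n) ℤ) *
        ((M⁻¹ : (Matrix (Fin n) (Fin n) ℤ)ˣ) : Matrix (Fin n) (Fin n) ℤ) = 1 := M.mul_inv
    have h2 := congrArg Matrix.transpose h1
    rw [Matrix.transpose_mul, hM, Matrix.transpose_transpose, Matrix.transpose_one] at h2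
    exact h2
  have hΨ' : ∀ x, Ψ x = ∑ k ∈ Finset.Icc (-(N : ℤ)) (N : ℤ),
      c k * e16 (∑ j, (l k j : ℝ) * x j) := hΨ
  have hR : ((∑ k ∈ Finset.Icc 1 N, c (k : ℤ) *
          Complex.exp (2 * (π : ℂ) * Complex.I *
            ((-(∑ j ∈ Finset.range k, ∑ i, (l (j : ℤ) i : ℝ) * b i) : ℝ) : ℂ)))
        + c 0
        + (∑ k ∈ Finset.Icc 1 (N - 1), c (-(k : ℤ)) *
          Complex.exp (2 * (π : ℂ) * Complex.I *
            (((∑ j ∈ Finset.Icc 1 k, ∑ i, (l (-(j : ℤ)) i : ℝ) * b i : ℝ)) : ℂ))))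
      = ∑ k ∈ Finset.Icc (-(N : ℤ)) N, c k * e16 (-Θ k) := by
    rw [split16]
    obtain ⟨N', rfl⟩ : ∃ N', N = N' + 1 := ⟨N - 1, by omega⟩
    rw [Finset.sum_Icc_succ_top (b := N') (by omega) (fun k : ℕ => c (-(k:ℤ)) * e16 (-Θ (-(k:ℤ)))),
      hsupp (-((N' + 1 : ℕ) : ℤ)) (Or.inr le_rfl), zero_mul, add_zero, Nat.add_sub_cancel]
    congr 1
    · congr 1
      · refine Finset.sum_congr rfl fun k _ => ?_
        simp only [Θ, Th16, e16]
        simp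
      · simp [Θ, Th16, e16_zero]
    · refine Finset.sum_congr rfl fun k _ => ?_
      simp only [Θ, Th16, e16]
      simp
  rw [hR]
  constructor
  · rintro ⟨u, hu, hp, he⟩
    obtain ⟨w, hw, hc⟩ := fwd16 A _ hC b T hT l hs hinj N c hsupp u hu.continuous hp
      (fun x => by rw [← hΨ', he])
    refine tele16 (fun k => w k * e16 (-Θ k)) _ N (fun k hk => by rw [hsupp k hk, zero_mul]) ?_ ?_
    · intro k
      have h1 := hΘ (k - 1)
      rw [sub_add_cancel] at h1
      have h2 : e16 (-Θ (k - 1)) = e16 (∑ j, (l (k - 1) j : ℝ) * b j) * e16 (-Θ k) := by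
        rw [← e16_add, h1]; congr 1; ring
      simp only [h2]
      rw [hc k]; ring
    · rw [tendsto_zero_iff_norm_tendsto_zero] at hw ⊢
      simpa [e16_norm] using hw
  · intro h0
    obtain ⟨u, hu, hp, he⟩ := bwd16 A b T hT l hs N c Θ hΘ h0
    exact ⟨u, hu, hp, fun x => by rw [hΨ', he]⟩
end

section
/- Let T: 𝕋^d → 𝕋^d, Tx = xA + b, be a uniquely ergodic skew-translation (A upper-triangular unipotent, A ≠ Id). The set of trigonometric polynomials Ψ on 𝕋^d such that Ψ − ∫Ψ is a smooth coboundary for T (i.e., Ψ is smoothly cohomologous to a constant) is dense in the space of all trigonometric polynomials with the supremum norm, hence dense in C(𝕋^d). -/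
open Filter MeasureTheory Real

lemma aux_uniform {X : Type*} [TopologicalSpace X] [CompactSpace X] [T2Space X]
    [MeasurableSpace X] [BorelSpace X] (T : C(X, X)) (g : C(X, ℝ)) (c : ℝ)
    (h : ∀ y, Tendsto (fun N : ℕ => (∑ n ∈ Finset.range N, g (T^[n] y)) / N) atTop (nhds c))
    (ε : ℝ) (hε : 0 < ε) :
    ∃ N : ℕ, ∀ y, |(∑ n ∈ Finset.range (N+1), g (T^[n] y)) / ((N+1 : ℕ) : ℝ) - c| < ε := by
  by_contra hcon
  push Not at hcon
  choose x hx using hcon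
  let a : C(X, ℝ) → ℕ → ℝ := fun f k =>
    (∑ n ∈ Finset.range (k+1), f (T^[n] (x k))) / ((k+1 : ℕ) : ℝ)
  let U : Ultrafilter ℕ := hyperfilter ℕ
  have hU : (U : Filter ℕ) ≤ atTop := Nat.hyperfilter_le_atTop
  have hpos : ∀ k : ℕ, (0:ℝ) < ((k+1 : ℕ) : ℝ) := fun k => by positivity
  have habs : ∀ f k, |a f k| ≤ ‖f‖ := by
    intro f k
    simp only [a]
    rw [abs_div, abs_of_pos (hpos k), div_le_iff₀ (hpos k)]
    refine (Finset.abs_sum_le_sum_abs _ _).trans ?_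
    refine (Finset.sum_le_card_nsmul _ _ ‖f‖ fun i _ => f.norm_coe_le_norm _).trans ?_
    simp [mul_comm]
  have hL : ∀ f, ∃ l, Tendsto (a f) U (nhds l) := by
    intro f
    have hc : IsCompact (Set.Icc (-‖f‖) ‖f‖) := isCompact_Icc
    obtain ⟨l, -, hl⟩ := hc.ultrafilter_le_nhds (U.map (a f)) (by
      rw [le_principal_iff]
      exact Filter.Eventually.of_forall (f := (U : Filter ℕ)) fun k => abs_le.1 (habs f k))
    exact ⟨l, hl⟩
  choose L hL using hL
  have hadd : ∀ f f', L (f + f') = L f + L f' := by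
    intro f f'
    refine tendsto_nhds_unique (hL _) (((hL f).add (hL f')).congr fun k => ?_)
    simp [a, Finset.sum_add_distrib, add_div]
  have hsmul : ∀ (r : ℝ) f, L (r • f) = r * L f := by
    intro r f
    refine tendsto_nhds_unique (hL _) (((hL f).const_mul r).congr fun k => ?_)
    simp only [a, ContinuousMap.smul_apply, smul_eq_mul, ← Finset.mul_sum, mul_div_assoc]
  have hnn : ∀ f : C(X, ℝ), (∀ y, 0 ≤ f y) → 0 ≤ L f := by
    intro f hf
    refine ge_of_tendsto' (hL f) fun k => ?_
    exact div_nonneg (Finset.sum_nonneg fun i _ => hf _) (hpos k).le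
  have hone : ∀ r : ℝ, L (ContinuousMap.const X r) = r := by
    intro r
    refine tendsto_nhds_unique (hL _) (tendsto_const_nhds.congr fun k => ?_)
    have := (hpos k).ne'
    simp only [a, ContinuousMap.const_apply, Finset.sum_const, Finset.card_range, nsmul_eq_mul]
    field_simp
  have hinv : ∀ f : C(X, ℝ), L (f.comp T) = L f := by
    intro f
    have h0 : Tendsto (fun k => a (f.comp T) k - a f k) U (nhds 0) := by
      refine Tendsto.mono_left ?_ hU
      have h2 : Tendsto (fun k : ℕ => (2 * ‖f‖) / ((k+1 : ℕ) : ℝ)) atTop (nhds 0) :=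
        (tendsto_const_nhds.div_atTop tendsto_natCast_atTop_atTop).comp (tendsto_add_atTop_nat 1)
      refine squeeze_zero_norm (fun k => ?_) h2
      have : a (f.comp T) k - a f k = (f (T^[k+1] (x k)) - f (x k)) / ((k+1 : ℕ) : ℝ) := by
        simp only [a]
        rw [← sub_div, ← Finset.sum_sub_distrib]
        congr 1
        have := Finset.sum_range_sub (fun n => f (T^[n] (x k))) (k+1)
        simp only [Function.iterate_zero, id] at this
        rw [← this]
        refine Finset.sum_congr rfl fun n _ => ?_
        simp [Function.iterate_succ_apply']
      rw [this, norm_div, Real.norm_of_nonneg (hpos k).le]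
      gcongr
      refine (norm_sub_le _ _).trans ?_
      have := f.norm_coe_le_norm (T^[k+1] (x k))
      have := f.norm_coe_le_norm (x k)
      linarith
    have := tendsto_nhds_unique h0 ((hL _).sub (hL _))
    linarith
  let S : ℕ → C(X, ℝ) := fun N =>
    ⟨fun y => ∑ n ∈ Finset.range N, g (T^[n] y), by
      have : ∀ n, Continuous (T^[n]) := fun n => T.continuous.iterate n
      fun_prop⟩
  have hS : ∀ N : ℕ, L (S N) = N * L g := by
    have hit : ∀ n : ℕ, L ⟨fun y => g (T^[n] y), g.continuous.comp (T.continuous.iterate n)⟩ = L g := by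
      intro n
      induction n with
      | zero => rfl
      | succ n ih => rw [← ih, ← hinv ⟨fun y => g (T^[n] y), _⟩]; rfl
    intro N
    induction N with
    | zero =>
      have := hone 0
      simp only [Nat.cast_zero, zero_mul]
      convert this using 2
      ext y; simp [S]
    | succ N ih =>
      have : S (N+1) = S N + ⟨fun y => g (T^[N] y), g.continuous.comp (T.continuous.iterate N)⟩ := by
        ext y; simp [S, Finset.sum_range_succ]
      rw [this, hadd, ih, hit]; push_cast; ring
  let Λ : CompactlySupportedContinuousMap X ℝ →ₚ[ℝ] ℝ := PositiveLinearMap.mk₀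
    { toFun := fun f => L f.toContinuousMap
      map_add' := fun f f' => hadd _ _
      map_smul' := fun r f => hsmul _ _ } (fun f hf => hnn _ hf)
  let μ := RealRMK.rieszMeasure Λ
  have hμ : ∀ f : C(X, ℝ), ∫ y, f y ∂μ = L f := fun f =>
    RealRMK.integral_rieszMeasure Λ (CompactlySupportedContinuousMap.continuousMapEquiv f)
  have hfin : IsFiniteMeasure μ := by
    have : μ.Regular := by infer_instance
    exact ⟨isCompact_univ.measure_lt_top⟩
  have hD : Tendsto (fun N : ℕ => ∫ y, (S N y) / N ∂μ) atTop (nhds (∫ y, c ∂μ)) := by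
    refine tendsto_integral_of_dominated_convergence (fun _ => ‖g‖) (fun N => ?_)
      (integrable_const _) (fun N => ?_) ?_
    · exact (((S N).continuous.div_const _).aestronglyMeasurable)
    · refine Eventually.of_forall fun y => ?_
      rw [norm_div, RCLike.norm_natCast]
      refine div_le_of_le_mul₀ (by positivity) (by positivity) ?_
      simp only [S, ContinuousMap.coe_mk]
      refine (norm_sum_le _ _).trans ?_
      refine (Finset.sum_le_card_nsmul _ _ ‖g‖ fun i _ => g.norm_coe_le_norm _).trans ?_
      simp [mul_comm]
    · exact Eventually.of_forall fun y => h y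
  have e1 : ∫ y, c ∂μ = c := (hμ (ContinuousMap.const X c)).trans (hone c)
  have hLg : L g = c := by
    rw [e1] at hD
    refine tendsto_nhds_unique (tendsto_const_nhds.congr' ?_) hD
    filter_upwards [eventually_gt_atTop 0] with N hN
    have : (N:ℝ) ≠ 0 := by positivity
    rw [integral_div, hμ, hS]
    field_simp
  have h3 : ε ≤ |L g - c| :=
    ge_of_tendsto' ((hL g).sub_const c).abs fun k => hx k
  rw [hLg] at h3
  simp at h3
  linarith

/-- real trigonometric polynomials on `𝕋^d` (periodic model) -/
def trigSpan (d : ℕ) : Submodule ℝ ((Fin d → ℝ) → ℝ) :=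
  Submodule.span ℝ
          ((Set.range fun l : Fin d → ℤ =>
              fun x : Fin d → ℝ => Real.cos (2 * π * ∑ j, (l j : ℝ) * x j)) ∪
           (Set.range fun l : Fin d → ℤ =>
              fun x : Fin d → ℝ => Real.sin (2 * π * ∑ j, (l j : ℝ) * x j)))

lemma cos_mem_trigSpan {d : ℕ} (l : Fin d → ℤ) :
    (fun x : Fin d → ℝ => Real.cos (2 * π * ∑ j, (l j : ℝ) * x j)) ∈ trigSpan d :=
  Submodule.subset_span (Or.inl ⟨l, rfl⟩)

lemma sin_mem_trigSpan {d : ℕ} (l : Fin d → ℤ) :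
    (fun x : Fin d → ℝ => Real.sin (2 * π * ∑ j, (l j : ℝ) * x j)) ∈ trigSpan d :=
  Submodule.subset_span (Or.inr ⟨l, rfl⟩)

lemma const_mem_trigSpan {d : ℕ} (c : ℝ) : (fun _ : Fin d → ℝ => c) ∈ trigSpan d := by
  have := (trigSpan d).smul_mem c (cos_mem_trigSpan (0 : Fin d → ℤ))
  convert this using 1
  ext x; simp

lemma trigSpan_props {d : ℕ} (g : (Fin d → ℝ) → ℝ) (hg : g ∈ trigSpan d) :
    ContDiff ℝ (⊤ : ℕ∞) g ∧ (∀ x (p : Fin d → ℤ), g (x + fun j => (p j : ℝ)) = g x) ∧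
      ∃ C, ∀ x, |g x| ≤ C := by
  have key : ∀ (l : Fin d → ℤ) (x : Fin d → ℝ) (p : Fin d → ℤ),
      2 * π * ∑ j, (l j : ℝ) * (x + fun j => (p j : ℝ)) j =
        2 * π * ∑ j, (l j : ℝ) * x j + ((∑ j, l j * p j : ℤ) : ℝ) * (2 * π) := by
    intro l x p
    push_cast
    simp only [Pi.add_apply, mul_add, Finset.sum_add_distrib]
    ring
  unfold trigSpan at hg
  induction hg using Submodule.span_induction with
  | mem g hg =>
    rcases hg with ⟨l, rfl⟩ | ⟨l, rfl⟩
    · refine ⟨by fun_prop, fun x p => ?_, 1, fun x => Real.abs_cos_le_one _⟩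
      simp only [key, Real.cos_add_int_mul_two_pi]
    · refine ⟨by fun_prop, fun x p => ?_, 1, fun x => Real.abs_sin_le_one _⟩
      simp only [key, Real.sin_add_int_mul_two_pi]
  | zero => exact ⟨contDiff_const, fun _ _ => rfl, 0, fun x => by simp⟩
  | add f g _ _ hf hg =>
    obtain ⟨a1, a2, C, a3⟩ := hf
    obtain ⟨b1, b2, D, b3⟩ := hg
    refine ⟨a1.add b1, fun x p => by simp only [Pi.add_apply, a2, b2], C + D, fun x => ?_⟩
    exact (abs_add_le _ _).trans (add_le_add (a3 x) (b3 x))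
  | smul r f _ hf =>
    obtain ⟨a1, a2, C, a3⟩ := hf
    refine ⟨contDiff_const.smul a1, fun x p => by simp only [Pi.smul_apply, a2], |r| * C,
      fun x => ?_⟩
    simp only [Pi.smul_apply, smul_eq_mul, abs_mul]
    exact mul_le_mul_of_nonneg_left (a3 x) (abs_nonneg r)

lemma trigSpan_comp {d : ℕ} (A : Matrix (Fin d) (Fin d) ℤ)
    (b : Fin d → ℝ) (T : (Fin d → ℝ) → Fin d → ℝ)
    (hT : ∀ x j, T x j = (∑ i, (A i j : ℝ) * x i) + b j)
    (g : (Fin d → ℝ) → ℝ) (hg : g ∈ trigSpan d) : (fun x => g (T x)) ∈ trigSpan d := by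
  have key : ∀ (l : Fin d → ℤ) (x : Fin d → ℝ),
      2 * π * ∑ j, (l j : ℝ) * T x j =
        2 * π * ∑ i, (((∑ j, l j * A i j : ℤ)) : ℝ) * x i + 2 * π * ∑ j, (l j : ℝ) * b j := by
    intro l x
    rw [← mul_add]
    congr 1
    simp only [hT, mul_add, Finset.sum_add_distrib]
    congr 1
    push_cast
    simp only [Finset.mul_sum, Finset.sum_mul]
    rw [Finset.sum_comm]
    simp only [mul_assoc]
  unfold trigSpan at hg
  induction hg using Submodule.span_induction with
  | mem g hg =>
    rcases hg with ⟨l, rfl⟩ | ⟨l, rfl⟩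
    · have := (trigSpan d).sub_mem
        ((trigSpan d).smul_mem (Real.cos (2 * π * ∑ j, (l j : ℝ) * b j))
          (cos_mem_trigSpan (fun i => ∑ j, l j * A i j)))
        ((trigSpan d).smul_mem (Real.sin (2 * π * ∑ j, (l j : ℝ) * b j))
          (sin_mem_trigSpan (fun i => ∑ j, l j * A i j)))
      convert this using 1
      ext x
      simp only [key, Real.cos_add, Pi.sub_apply, Pi.smul_apply, smul_eq_mul]
      ring
    · have := (trigSpan d).add_mem
        ((trigSpan d).smul_mem (Real.cos (2 * π * ∑ j, (l j : ℝ) * b j))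
          (sin_mem_trigSpan (fun i => ∑ j, l j * A i j)))
        ((trigSpan d).smul_mem (Real.sin (2 * π * ∑ j, (l j : ℝ) * b j))
          (cos_mem_trigSpan (fun i => ∑ j, l j * A i j)))
      convert this using 1
      ext x
      simp only [key, Real.sin_add, Pi.add_apply, Pi.smul_apply, smul_eq_mul]
      ring
  | zero => exact (trigSpan d).zero_mem
  | add f g _ _ hf hg => exact (trigSpan d).add_mem hf hg
  | smul r f _ hf => exact (trigSpan d).smul_mem r hf

/-- the projection to the torus -/
def torusProj (d : ℕ) : (Fin d → ℝ) → UnitAddTorus (Fin d) :=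
  Pi.map (fun _ => ((↑) : ℝ → UnitAddCircle))

lemma torusProj_quot (d : ℕ) : IsOpenQuotientMap (torusProj d) :=
  IsOpenQuotientMap.piMap fun _ => QuotientAddGroup.isOpenQuotientMap_mk

lemma exists_desc {d : ℕ} (f : (Fin d → ℝ) → ℝ) (hf : Continuous f)
    (hp : ∀ x (p : Fin d → ℤ), f (x + fun j => (p j : ℝ)) = f x) :
    ∃ F : C(UnitAddTorus (Fin d), ℝ), ∀ x, F (torusProj d x) = f x := by
  have hq := torusProj_quot d
  have h1 : ∀ x y, torusProj d x = torusProj d y → f x = f y := by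
    intro x y hxy
    have : ∀ j, ∃ n : ℤ, x j = y j + n := by
      intro j
      have h2 : ((x j : ℝ) : UnitAddCircle) = (y j : ℝ) := congrFun hxy j
      rw [← sub_eq_zero, ← AddCircle.coe_sub] at h2
      obtain ⟨n, hn⟩ := (AddCircle.coe_eq_zero_iff (1 : ℝ)).1 h2
      refine ⟨n, ?_⟩
      simp only [zsmul_eq_mul, mul_one] at hn
      linarith
    choose p hp' using this
    rw [← hp y p]
    congr 1
    ext j
    exact hp' j
  choose s hs using hq.surjective
  have h2 : ∀ x, f (s (torusProj d x)) = f x := fun x => h1 _ _ (hs _)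
  refine ⟨⟨fun y => f (s y), ?_⟩, h2⟩
  rw [hq.isQuotientMap.continuous_iff]
  convert hf using 1
  ext x
  exact h2 x

lemma re_mem_trigSpan {d : ℕ} (P : C(UnitAddTorus (Fin d), ℂ))
    (hP : P ∈ Submodule.span ℂ (Set.range (UnitAddTorus.mFourier (d := Fin d)))) :
    (fun x => (P (torusProj d x)).re) ∈ trigSpan d ∧
    (fun x => (P (torusProj d x)).im) ∈ trigSpan d := by
  have key : ∀ (l : Fin d → ℤ) x, UnitAddTorus.mFourier l (torusProj d x) =
      Complex.exp (((2 * π * ∑ j, (l j : ℝ) * x j : ℝ) : ℂ) * Complex.I) := by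
    intro l x
    simp only [UnitAddTorus.mFourier, ContinuousMap.coe_mk, torusProj, Pi.map_apply,
      fourier_coe_apply]
    rw [← Complex.exp_sum]
    congr 1
    push_cast
    simp only [Finset.mul_sum, Finset.sum_mul]
    refine Finset.sum_congr rfl fun i _ => ?_
    simp
    ring
  induction hP using Submodule.span_induction with
  | mem g hg =>
    obtain ⟨l, rfl⟩ := hg
    simp only [key, Complex.exp_ofReal_mul_I_re, Complex.exp_ofReal_mul_I_im]
    exact ⟨cos_mem_trigSpan l, sin_mem_trigSpan l⟩
  | zero => exact ⟨(trigSpan d).zero_mem, (trigSpan d).zero_mem⟩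
  | add f g _ _ hf hg =>
    exact ⟨(trigSpan d).add_mem hf.1 hg.1, (trigSpan d).add_mem hf.2 hg.2⟩
  | smul r f _ hf =>
    constructor
    · have := (trigSpan d).sub_mem ((trigSpan d).smul_mem r.re hf.1)
        ((trigSpan d).smul_mem r.im hf.2)
      convert this using 1
      ext x; simp [Complex.mul_re]
    · have := (trigSpan d).add_mem ((trigSpan d).smul_mem r.re hf.2)
        ((trigSpan d).smul_mem r.im hf.1)
      convert this using 1
      ext x; simp [Complex.mul_im]

lemma exists_trig_approx {d : ℕ} (f : (Fin d → ℝ) → ℝ) (hf : Continuous f)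
    (hp : ∀ x (p : Fin d → ℤ), f (x + fun j => (p j : ℝ)) = f x) (ε : ℝ) (hε : 0 < ε) :
    ∃ G ∈ trigSpan d, ∀ x, |f x - G x| < ε := by
  obtain ⟨F, hF⟩ := exists_desc f hf hp
  let Fc : C(UnitAddTorus (Fin d), ℂ) := ⟨fun y => (F y : ℂ), by fun_prop⟩
  have hmem : Fc ∈ (Submodule.span ℂ
      (Set.range (UnitAddTorus.mFourier (d := Fin d)))).topologicalClosure := by
    rw [UnitAddTorus.span_mFourier_closure_eq_top]; trivial
  obtain ⟨P, hP, hd⟩ := Metric.mem_closure_iff.1 hmem ε hε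
  refine ⟨_, (re_mem_trigSpan P hP).1, fun x => ?_⟩
  have h1 := ContinuousMap.dist_lt_iff hε |>.1 hd (torusProj d x)
  rw [Complex.dist_eq] at h1
  refine lt_of_le_of_lt ?_ h1
  have := Complex.abs_re_le_norm (Fc (torusProj d x) - P (torusProj d x))
  simpa [Fc, hF] using this

lemma uniform_torus {d : ℕ} (A : Matrix (Fin d) (Fin d) ℤ)
    (b : Fin d → ℝ) (T : (Fin d → ℝ) → Fin d → ℝ)
    (hT : ∀ x j, T x j = (∑ i, (A i j : ℝ) * x i) + b j)
    (f : (Fin d → ℝ) → ℝ) (hf : Continuous f)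
    (hp : ∀ x (p : Fin d → ℤ), f (x + fun j => (p j : ℝ)) = f x) (c : ℝ)
    (h : ∀ x, Tendsto (fun N : ℕ => (∑ n ∈ Finset.range N, f (T^[n] x)) / N) atTop (nhds c))
    (ε : ℝ) (hε : 0 < ε) :
    ∃ N : ℕ, ∀ x, |(∑ n ∈ Finset.range (N+1), f (T^[n] x)) / ((N+1 : ℕ) : ℝ) - c| < ε := by
  obtain ⟨F, hF⟩ := exists_desc f hf hp
  let T' : C(UnitAddTorus (Fin d), UnitAddTorus (Fin d)) :=
    ⟨fun y j => (∑ i, A i j • y i) + (b j : UnitAddCircle), by fun_prop⟩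
  have hc : ∀ x, T' (torusProj d x) = torusProj d (T x) := by
    intro x
    ext j
    simp only [T', torusProj, ContinuousMap.coe_mk, Pi.map_apply, hT]
    let φ : ℝ →+ UnitAddCircle := QuotientAddGroup.mk' _
    change (∑ i, A i j • φ (x i)) + φ (b j) = φ ((∑ i, (A i j : ℝ) * x i) + b j)
    rw [map_add, map_sum]
    congr 1
    refine Finset.sum_congr rfl fun i _ => ?_
    rw [← map_zsmul, zsmul_eq_mul]
  have hit : ∀ n x, T'^[n] (torusProj d x) = torusProj d (T^[n] x) := by
    intro n
    induction n with
    | zero => intro x; rfl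
    | succ n ih => intro x; simp only [Function.iterate_succ_apply, hc, ih]
  have hsum : ∀ N x, ∑ n ∈ Finset.range N, F (T'^[n] (torusProj d x))
      = ∑ n ∈ Finset.range N, f (T^[n] x) := fun N x => by simp only [hit, hF]
  obtain ⟨N, hN⟩ := aux_uniform T' F c (fun y => by
    obtain ⟨x, rfl⟩ := (torusProj_quot d).surjective y
    simp only [hsum]
    exact h x) ε hε
  refine ⟨N, fun x => ?_⟩
  have := hN (torusProj d x)
  rwa [hsum] at this



/-- For a uniquely ergodic skew-translation `T x = xA + b` on `𝕋^d` (periodic model),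
the trigonometric polynomials `Ψ` that are smoothly cohomologous to a constant
(`Ψ − ∫Ψ = u∘T − u` with `u` smooth) are dense in `C(𝕋^d)` for the sup norm. -/
theorem stmt_17 (d : ℕ) (hd : 1 ≤ d) (A : Matrix (Fin d) (Fin d) ℤ)
    (hUT : A.BlockTriangular id) (hdiag : ∀ i, A i i = 1) (hA : A ≠ 1)
    (b : Fin d → ℝ) (T : (Fin d → ℝ) → Fin d → ℝ)
    (hT : ∀ x j, T x j = (∑ i, (A i j : ℝ) * x i) + b j)
    (hUE : ∀ f : (Fin d → ℝ) → ℝ, Continuous f →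
      (∀ x (p : Fin d → ℤ), f (x + fun j => (p j : ℝ)) = f x) →
      ∀ x, Tendsto (fun N : ℕ => (∑ n ∈ Finset.range N, f (T^[n] x)) / N) atTop
        (nhds (∫ y in (Set.univ.pi fun _ : Fin d => Set.Icc (0:ℝ) 1), f y))) :
    ∀ f : (Fin d → ℝ) → ℝ, Continuous f →
      (∀ x (p : Fin d → ℤ), f (x + fun j => (p j : ℝ)) = f x) →
      ∀ ε : ℝ, 0 < ε →
      ∃ Ψ : (Fin d → ℝ) → ℝ,
        (Ψ ∈ Submodule.span ℝ
          ((Set.range fun l : Fin d → ℤ =>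
              fun x : Fin d → ℝ => Real.cos (2 * π * ∑ j, (l j : ℝ) * x j)) ∪
           (Set.range fun l : Fin d → ℤ =>
              fun x : Fin d → ℝ => Real.sin (2 * π * ∑ j, (l j : ℝ) * x j))))
        ∧ (∃ u : (Fin d → ℝ) → ℝ, ContDiff ℝ (⊤ : ℕ∞) u ∧
            (∀ x (p : Fin d → ℤ), u (x + fun j => (p j : ℝ)) = u x) ∧
            ∀ x, Ψ x - (∫ y in (Set.univ.pi fun _ : Fin d => Set.Icc (0:ℝ) 1), Ψ y)
              = u (T x) - u x)
        ∧ ∀ x, |f x - Ψ x| < ε := by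
  intro f hf hp ε hε
  change ∃ Ψ : (Fin d → ℝ) → ℝ, Ψ ∈ trigSpan d ∧ _
  obtain ⟨G, hG, hfG⟩ := exists_trig_approx f hf hp (ε / 2) (by positivity)
  obtain ⟨G1, G2, -⟩ := trigSpan_props G hG
  set c : ℝ := ∫ y in (Set.univ.pi fun _ : Fin d => Set.Icc (0:ℝ) 1), G y with hc
  obtain ⟨N, hN⟩ := uniform_torus A b T hT G G1.continuous G2 c
    (hUE G G1.continuous G2) (ε / 2) (by positivity)
  set M : ℝ := ((N + 1 : ℕ) : ℝ) with hM
  have hM0 : M ≠ 0 := by rw [hM]; positivity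
  have hit : ∀ n : ℕ, (fun x => G (T^[n] x)) ∈ trigSpan d := by
    intro n
    induction n with
    | zero => exact hG
    | succ n ih =>
      have := trigSpan_comp A b T hT _ ih
      simpa only [Function.iterate_succ_apply] using this
  have hsum : ∀ m : ℕ, (fun x => ∑ n ∈ Finset.range m, G (T^[n] x)) ∈ trigSpan d := by
    intro m
    have := (trigSpan d).sum_mem (t := Finset.range m) fun n _ => hit n
    convert this using 1
    ext x; simp
  let Ψ : (Fin d → ℝ) → ℝ := fun x => G x - (∑ n ∈ Finset.range (N+1), G (T^[n] x)) / M + c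
  have hΨ : Ψ ∈ trigSpan d := by
    have := (trigSpan d).add_mem ((trigSpan d).sub_mem hG
      ((trigSpan d).smul_mem M⁻¹ (hsum (N+1)))) (const_mem_trigSpan c)
    convert this using 1
    ext x
    simp [Ψ, div_eq_inv_mul]
  let u : (Fin d → ℝ) → ℝ := fun x =>
    -M⁻¹ * ∑ m ∈ Finset.range (N+1), ∑ n ∈ Finset.range m, G (T^[n] x)
  have hu : u ∈ trigSpan d := by
    have := (trigSpan d).smul_mem (-M⁻¹)
      ((trigSpan d).sum_mem (t := Finset.range (N+1)) fun m _ => hsum m)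
    convert this using 1
    ext x; simp [u]
  have hcob : ∀ x, Ψ x - c = u (T x) - u x := by
    intro x
    have h1 : ∀ m : ℕ, ∑ n ∈ Finset.range m, G (T^[n] (T x)) - ∑ n ∈ Finset.range m, G (T^[n] x)
        = G (T^[m] x) - G x := by
      intro m
      rw [← Finset.sum_sub_distrib]
      exact Finset.sum_range_sub (fun n => G (T^[n] x)) m
    have h2 : u (T x) - u x = -M⁻¹ * ∑ m ∈ Finset.range (N+1), (G (T^[m] x) - G x) := by
      simp only [u]
      rw [← mul_sub, ← Finset.sum_sub_distrib]
      simp only [h1]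
    rw [h2, Finset.sum_sub_distrib]
    simp only [Ψ, Finset.sum_const, Finset.card_range, nsmul_eq_mul, ← hM]
    field_simp
    ring
  obtain ⟨u1, u2, C, u3⟩ := trigSpan_props u hu
  obtain ⟨Ψ1, Ψ2, -⟩ := trigSpan_props Ψ hΨ
  have hmean : ∫ y in (Set.univ.pi fun _ : Fin d => Set.Icc (0:ℝ) 1), Ψ y = c := by
    refine tendsto_nhds_unique (hUE Ψ Ψ1.continuous Ψ2 0) ?_
    have h0 : Tendsto (fun n : ℕ => (u (T^[n] 0) - u 0) / n) atTop (nhds 0) := by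
      have h2 : Tendsto (fun k : ℕ => (C + C) / (k : ℝ)) atTop (nhds 0) :=
        tendsto_const_nhds.div_atTop tendsto_natCast_atTop_atTop
      refine squeeze_zero_norm (fun k => ?_) h2
      rw [norm_div, RCLike.norm_natCast]
      gcongr
      exact (norm_sub_le _ _).trans (add_le_add (u3 _) (u3 _))
    have h1 : Tendsto (fun n : ℕ => (u (T^[n] 0) - u 0) / n + c) atTop (nhds c) := by
      simpa using h0.add_const c
    refine h1.congr' ?_
    filter_upwards [eventually_gt_atTop 0] with n hn
    have hn0 : (n : ℝ) ≠ 0 := by positivity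
    have : ∑ k ∈ Finset.range n, (Ψ (T^[k] 0) - c) = u (T^[n] 0) - u 0 := by
      simp only [hcob, ← Function.iterate_succ_apply' T]
      exact Finset.sum_range_sub (fun k => u (T^[k] 0)) n
    rw [← this, Finset.sum_sub_distrib]
    simp only [Finset.sum_const, Finset.card_range, nsmul_eq_mul]
    field_simp
    ring
  refine ⟨Ψ, hΨ, ⟨u, u1, u2, fun x => ?_⟩, fun x => ?_⟩
  · rw [hmean]; exact hcob x
  · have h1 := abs_lt.1 (hfG x)
    have h2 := abs_lt.1 (hN x)
    simp only [Ψ]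
    rw [abs_lt]
    constructor <;> linarith [h1.1, h1.2, h2.1, h2.2]
end
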